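/- Let n ≥ 4, p = 1 and q = n − 2. Then the fundamental group of Ω := S^n ∖ (S^1 ∪ S^{n−2}), the complement of the two complementary great subspheres, is isomorphic to ℤ. -/

import Mathlib

noncomputable section

open Set

/-- The great circle `S^1 = {v ∈ S^n : v_k = 0 for k ≥ 2}` (0-based indices),
i.e. the unit sphere of the `ℝ^{p+1} = ℝ²` factor for `p = 1`. -/
def greatSphereP (n p : ℕ) : Set (EuclideanSpace ℝ (Fin (n + 1))) :=
  {v | ‖v‖ = 1 ∧ ∀ k : Fin (n + 1), p + 1 ≤ (k : ℕ) → v k = 0}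

/-- The complementary great sphere `S^q = {v ∈ S^n : v_k = 0 for k < p+1}`. -/
def greatSphereQ (n p : ℕ) : Set (EuclideanSpace ℝ (Fin (n + 1))) :=
  {v | ‖v‖ = 1 ∧ ∀ k : Fin (n + 1), (k : ℕ) < p + 1 → v k = 0}

/-- `Ω := S^n ∖ (S^p ∪ S^q)` with its subspace topology. -/
def Omega (n p : ℕ) : Set (EuclideanSpace ℝ (Fin (n + 1))) :=
  {v | ‖v‖ = 1} \ (greatSphereP n p ∪ greatSphereQ n p)

theorem aux_homotopic_of_close {F : Type*} [NormedAddCommGroup F] [NormedSpace ℝ F]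
    {x : ({0}ᶜ : Set F)} (γ η : Path x x)
    (h : ∀ t, ‖(η t : F) - (γ t : F)‖ < ‖(γ t : F)‖) : γ.Homotopic η := by
  refine ⟨⟨⟨⟨fun p => ⟨(γ p.2 : F) + (p.1 : ℝ) • ((η p.2 : F) - (γ p.2 : F)), ?_⟩, ?_⟩, ?_, ?_⟩, ?_⟩⟩
  · intro h0
    have h0 : (γ p.2 : F) + (p.1 : ℝ) • ((η p.2 : F) - (γ p.2 : F)) = 0 := h0
    have h1 : ‖(γ p.2 : F)‖ = (p.1 : ℝ) * ‖(η p.2 : F) - (γ p.2 : F)‖ := by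
      have h3 := congrArg norm (eq_neg_of_add_eq_zero_left h0)
      rwa [norm_neg, norm_smul, Real.norm_of_nonneg p.1.2.1] at h3
    have h2 : (p.1 : ℝ) * ‖(η p.2 : F) - (γ p.2 : F)‖ ≤ 1 * ‖(η p.2 : F) - (γ p.2 : F)‖ :=
      mul_le_mul_of_nonneg_right p.1.2.2 (norm_nonneg _)
    have := h p.2
    linarith
  · fun_prop
  · intro t; apply Subtype.ext; simp
  · intro t; apply Subtype.ext; simp
  · intro t s hs
    apply Subtype.ext
    rcases hs with rfl | rfl <;> simp

theorem aux_simplyConnected {F : Type*} [NormedAddCommGroup F] [NormedSpace ℝ F]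
    [FiniteDimensional ℝ F] (hF : 3 ≤ Module.finrank ℝ F) :
    SimplyConnectedSpace ({0}ᶜ : Set F) := by
  rw [simply_connected_iff_loops_nullhomotopic]
  constructor
  · rw [← isPathConnected_iff_pathConnectedSpace]
    apply isPathConnected_compl_singleton_of_one_lt_rank
    rw [← Module.finrank_eq_rank]
    exact_mod_cast (by omega : 1 < Module.finrank ℝ F)
  intro x γ
  let f : C(unitInterval, F) := ⟨fun t => (γ t : F), by fun_prop⟩
  obtain ⟨t0, -, ht0⟩ := isCompact_univ.exists_isMinOn (univ_nonempty (α := unitInterval))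
    (f.continuous.norm.continuousOn)
  have hδ : 0 < ‖f t0‖ := norm_pos_iff.2 (γ t0).2
  obtain ⟨N, hN0, hN⟩ : ∃ N : ℕ, N ≠ 0 ∧ ‖bernsteinApproximation N f - f‖ < ‖f t0‖ := by
    have h1 := (Metric.tendsto_nhds.1 (bernsteinApproximation_uniform f)) _ hδ
    obtain ⟨N, h2, h3⟩ := (h1.and (Filter.eventually_ne_atTop 0)).exists
    exact ⟨N, h3, by rwa [dist_eq_norm] at h2⟩
  set B := bernsteinApproximation N f with hB
  have hclose : ∀ t, ‖B t - f t‖ < ‖f t‖ := fun t =>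
    ((B - f).norm_coe_le_norm t).trans_lt (hN.trans_le (ht0 (mem_univ t)))
  have hBne : ∀ t, B t ≠ 0 := by
    intro t h
    have := hclose t
    simp [h] at this
  have hB0 : B 0 = x := by simp [hB, f]
  have hB1 : B 1 = x := by simp [hB, f, hN0]
  let η : Path x x := ⟨⟨fun t => ⟨B t, hBne t⟩, by fun_prop⟩, Subtype.ext hB0, Subtype.ext hB1⟩
  refine (aux_homotopic_of_close γ η hclose).trans ?_
  -- a direction missed by the polynomial loop
  let G : ℝ × ℝ → F := fun p => p.1 • ∑ k : Fin (N + 1),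
    ((N.choose k : ℝ) * p.2 ^ (k : ℕ) * (1 - p.2) ^ (N - (k : ℕ))) • f (bernstein.z k)
  have hG : ContDiff ℝ 1 G := by fun_prop
  obtain ⟨u, hu⟩ := (hG.dense_compl_range_of_finrank_lt_finrank (by simp; omega)).nonempty
  have hu0 : u ≠ 0 := by
    rintro rfl
    exact hu ⟨(0, 0), by simp [G]⟩
  have huB : ∀ (s : ℝ) t, s • B t ≠ u := by
    intro s t h
    apply hu
    refine ⟨(s, t), ?_⟩
    rw [← h]
    simp [G, hB, bernsteinApproximation.apply, bernstein_apply]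
  let S : Set F := {v | ∀ s : ℝ, s ≤ 0 → v ≠ s • u}
  have huS : u ∈ S := by
    intro s hs h
    have : (1 - s) • u = 0 := by rw [sub_smul, one_smul, ← h, sub_self]
    rcases smul_eq_zero.1 this with h | h
    · linarith
    · exact hu0 h
  have hstar : StarConvex ℝ u S := by
    intro v hv a b ha hb hab s hs h
    rcases hb.eq_or_lt with rfl | hb
    · have : a = 1 := by linarith
      subst this
      simp at h
      exact huS s hs h
    · apply hv ((s - a) / b) (div_nonpos_of_nonpos_of_nonneg (by linarith) hb.le)
      have : b • v = (s - a) • u := by rw [sub_smul, ← h]; abel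
      rw [div_eq_inv_mul, mul_smul, ← this, smul_smul, inv_mul_cancel₀ hb.ne', one_smul]
  have hBS : ∀ t, B t ∈ S := by
    intro t s hs h
    have hs0 : s ≠ 0 := by
      rintro rfl
      exact hBne t (by simpa using h)
    exact huB s⁻¹ t (by rw [h, smul_smul, inv_mul_cancel₀ hs0, one_smul])
  have : ContractibleSpace S := hstar.contractibleSpace ⟨u, huS⟩
  have hS0 : ∀ v ∈ S, v ∈ ({0}ᶜ : Set F) := fun v hv h => hv 0 le_rfl (by simpa using h)
  let y : S := ⟨x, hB0 ▸ hBS 0⟩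
  let η' : Path y y := ⟨⟨fun t => ⟨B t, hBS t⟩, by fun_prop⟩, Subtype.ext hB0, Subtype.ext hB1⟩
  have h1 := SimplyConnectedSpace.paths_homotopic η' (Path.refl y)
  let i : C(S, ({0}ᶜ : Set F)) := ⟨fun v => ⟨v, hS0 v v.2⟩, by fun_prop⟩
  have h2 := h1.map i
  exact h2

theorem aux_prod {X A B : Type*} [TopologicalSpace X] [TopologicalSpace A] [TopologicalSpace B]
    [SimplyConnectedSpace B] (e : X ≃ₜ A × B) (x : X) :
    Nonempty (FundamentalGroup X x ≃* FundamentalGroup A (e x).1) := by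
  let f : C(X, A) := ⟨fun y => (e y).1, by fun_prop⟩
  let g : C(X, B) := ⟨fun y => (e y).2, by fun_prop⟩
  let ec : C(A × B, X) := ⟨e.symm, by fun_prop⟩
  refine ⟨MulEquiv.ofBijective (FundamentalGroup.map f x) ⟨?_, ?_⟩⟩
  · rintro ⟨γ⟩ ⟨γ'⟩ h
    have h1 : (γ.map f.continuous).Homotopic (γ'.map f.continuous) := Quotient.exact h
    have h2 : (γ.map g.continuous).Homotopic (γ'.map g.continuous) :=
      SimplyConnectedSpace.paths_homotopic _ _
    have h3 : ((γ.map f.continuous).prod (γ.map g.continuous)).Homotopic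
        ((γ'.map f.continuous).prod (γ'.map g.continuous)) :=
      h1.elim fun H1 => h2.elim fun H2 => ⟨Path.Homotopic.prodHomotopy H1 H2⟩
    have h4 := h3.map ec
    have hx : x = e.symm (f x, g x) := by simp [f, g]
    have key : ∀ δ : Path x x, (((δ.map f.continuous).prod (δ.map g.continuous)).map
        ec.continuous).cast hx hx = δ := by
      intro δ
      ext t
      simp [f, g, ec]
    apply Quotient.sound
    show γ.Homotopic γ'
    rw [← key γ, ← key γ']
    obtain ⟨H⟩ := h4
    exact ⟨H.cast rfl rfl⟩
  · rintro ⟨γ⟩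
    have hx : x = ec (f x, g x) := by simp [f, g, ec]
    refine ⟨(Quotient.mk _ (((γ.prod (Path.refl (g x))).map ec.continuous).cast hx hx) :
      Path.Homotopic.Quotient x x), ?_⟩
    apply congrArg (Quotient.mk _)
    ext t
    simp [f, g, ec]

theorem aux_circle (z : Circle) :
    Nonempty (FundamentalGroup Circle z ≃* Multiplicative ℤ) := by
  obtain ⟨t, ht⟩ := Circle.exp_surjective z
  have e1 : FundamentalGroup Circle z ≃*
      (Multiplicative (AddSubgroup.zmultiples (2 * Real.pi)))ᵐᵒᵖ :=
    Circle.isAddQuotientCoveringMap_exp.fundamentalGroupEquiv ⟨t, ht⟩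
  have e2 : (Multiplicative (AddSubgroup.zmultiples (2 * Real.pi)))ᵐᵒᵖ ≃*
      Multiplicative (AddSubgroup.zmultiples (2 * Real.pi)) := (MulOpposite.opMulEquiv).symm
  have e3 : ℤ ≃+ AddSubgroup.zmultiples (2 * Real.pi) := by
    refine AddEquiv.ofBijective (zmultiplesHom _
      (⟨2 * Real.pi, AddSubgroup.mem_zmultiples _⟩ : AddSubgroup.zmultiples (2 * Real.pi))) ⟨?_, ?_⟩
    · intro a b h
      have h' := congrArg Subtype.val h
      simpa [Real.pi_ne_zero] using h'
    · rintro ⟨y, k, rfl⟩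
      exact ⟨k, Subtype.ext (by simp)⟩
  exact ⟨(e1.trans e2).trans (AddEquiv.toMultiplicative e3.symm)⟩

/-- The part of a vector in the first two coordinates, as a complex number. -/
def auxA {m : ℕ} (v : EuclideanSpace ℝ (Fin (m + 1 + 1))) : ℂ := ⟨v 0, v 1⟩

/-- The part of a vector in the remaining coordinates. -/
def auxB {m : ℕ} (v : EuclideanSpace ℝ (Fin (m + 1 + 1))) : EuclideanSpace ℝ (Fin m) :=
  WithLp.toLp 2 fun k => v k.succ.succ

/-- Assemble a vector from its two components. -/
def auxJ {m : ℕ} (a : ℂ) (b : EuclideanSpace ℝ (Fin m)) : EuclideanSpace ℝ (Fin (m + 1 + 1)) :=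
  WithLp.toLp 2 (Fin.cons a.re (Fin.cons a.im fun k => b k))

theorem auxA_auxJ {m : ℕ} (a : ℂ) (b : EuclideanSpace ℝ (Fin m)) : auxA (auxJ a b) = a := by
  apply Complex.ext <;> rfl

theorem auxB_auxJ {m : ℕ} (a : ℂ) (b : EuclideanSpace ℝ (Fin m)) : auxB (auxJ a b) = b := by
  ext k; rfl

theorem auxJ_auxA {m : ℕ} (v : EuclideanSpace ℝ (Fin (m + 1 + 1))) :
    auxJ (auxA v) (auxB v) = v := by
  ext k
  refine Fin.cases rfl (fun k => ?_) k
  refine Fin.cases rfl (fun k => rfl) k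

theorem aux_norm {m : ℕ} (v : EuclideanSpace ℝ (Fin (m + 1 + 1))) :
    ‖v‖ ^ 2 = ‖auxA v‖ ^ 2 + ‖auxB v‖ ^ 2 := by
  rw [EuclideanSpace.real_norm_sq_eq, EuclideanSpace.real_norm_sq_eq, Fin.sum_univ_succ,
    Fin.sum_univ_succ, Complex.sq_norm, Complex.normSq_apply]
  simp [auxA, auxB]
  ring

theorem aux_continuousA {m : ℕ} : Continuous (auxA (m := m)) := by
  have : auxA (m := m) = fun v => (v 0 : ℂ) + (v 1 : ℂ) * Complex.I := by
    ext v
    apply Complex.ext <;> simp [auxA]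
  rw [this]
  fun_prop

theorem aux_continuousB {m : ℕ} : Continuous (auxB (m := m)) := by
  unfold auxB
  fun_prop

theorem aux_continuousJ {m : ℕ} :
    Continuous (fun p : ℂ × EuclideanSpace ℝ (Fin m) => auxJ p.1 p.2) := by
  unfold auxJ
  refine (PiLp.continuous_toLp 2 _).comp (continuous_pi fun k => ?_)
  refine Fin.cases ?_ (fun k => ?_) k
  · exact Complex.continuous_re.comp continuous_fst
  · refine Fin.cases ?_ (fun k => ?_) k
    · exact Complex.continuous_im.comp continuous_fst
    · simp only [Fin.cons_succ]
      fun_prop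

theorem aux_mem {m : ℕ} (v : EuclideanSpace ℝ (Fin (m + 1 + 1))) :
    v ∈ Omega (m + 1) 1 ↔ ‖v‖ = 1 ∧ auxA v ≠ 0 ∧ auxB v ≠ 0 := by
  have hA : auxA v = 0 ↔ ∀ k : Fin (m + 1 + 1), (k : ℕ) < 1 + 1 → v k = 0 := by
    constructor
    · intro h k
      have h0 : v 0 = 0 := congrArg Complex.re h
      have h1 : v 1 = 0 := congrArg Complex.im h
      refine Fin.cases (fun _ => h0) (fun k => ?_) k
      refine Fin.cases (fun _ => h1) (fun k hk => ?_) k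
      simp at hk
    · intro h
      exact Complex.ext (h 0 (by simp)) (h 1 (by simp))
  have hB : auxB v = 0 ↔ ∀ k : Fin (m + 1 + 1), 1 + 1 ≤ (k : ℕ) → v k = 0 := by
    constructor
    · intro h k
      refine Fin.cases (fun hk => ?_) (fun k => ?_) k
      · simp at hk
      refine Fin.cases (fun hk => ?_) (fun k _ => ?_) k
      · simp at hk
      · exact congrArg (fun w : EuclideanSpace ℝ (Fin m) => w k) h
    · intro h
      ext k
      exact h k.succ.succ (by simp)
  simp only [Omega, greatSphereP, greatSphereQ, mem_sdiff, mem_union, mem_ofPred_eq, ← hA, ← hB]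
  tauto

/-- `Ω` is homeomorphic to the product of a circle and a punctured Euclidean space. -/
def auxHomeo (m : ℕ) :
    ↥(Omega (m + 1) 1) ≃ₜ Circle × ({0}ᶜ : Set (EuclideanSpace ℝ (Fin m))) where
  toFun v := (⟨auxA v.1 / (‖auxA v.1‖ : ℂ), by
      have := ((aux_mem _).1 v.2).2.1
      rw [Submonoid.unitSphere, ← SetLike.mem_coe]
      simp [this]⟩,
    ⟨‖auxA v.1‖⁻¹ • auxB v.1, by
      have := ((aux_mem _).1 v.2).2
      simp [this]⟩)
  invFun p := ⟨auxJ ((Real.sqrt (1 + ‖p.2.1‖ ^ 2))⁻¹ * (p.1 : ℂ))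
      ((Real.sqrt (1 + ‖p.2.1‖ ^ 2))⁻¹ • p.2.1), by
    have hp : 0 < 1 + ‖p.2.1‖ ^ 2 := by positivity
    have hs := Real.sqrt_pos.2 hp
    have hne : p.2.1 ≠ 0 := p.2.2
    rw [aux_mem, auxA_auxJ, auxB_auxJ]
    refine ⟨?_, ?_, ?_⟩
    · rw [← sq_eq_sq₀ (norm_nonneg _) zero_le_one, aux_norm, auxA_auxJ, auxB_auxJ, norm_smul,
        norm_mul]
      simp only [norm_inv, Complex.norm_real, Real.norm_of_nonneg hs.le, Circle.norm_coe, mul_pow,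
        inv_pow, Real.sq_sqrt hp.le]
      field_simp
    · simp [hs.ne']
    · simp [hs.ne', hne]⟩
  left_inv v := by
    obtain ⟨h1, h2, h3⟩ := (aux_mem _).1 v.2
    have hA : 0 < ‖auxA v.1‖ := norm_pos_iff.2 h2
    have hn := aux_norm v.1
    have hs : Real.sqrt (1 + ‖‖auxA v.1‖⁻¹ • auxB v.1‖ ^ 2) = ‖auxA v.1‖⁻¹ := by
      rw [norm_smul, norm_inv, norm_norm, Real.sqrt_eq_iff_mul_self_eq (by positivity)
        (by positivity)]
      rw [h1] at hn
      field_simp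
      linarith
    apply Subtype.ext
    simp only
    rw [hs]
    conv_rhs => rw [← auxJ_auxA v.1]
    congr 1
    · have : (‖auxA v.1‖ : ℂ) ≠ 0 := by exact_mod_cast hA.ne'
      push_cast
      field_simp
    · rw [inv_inv, smul_smul, mul_inv_cancel₀ hA.ne', one_smul]
  right_inv p := by
    have hp : 0 < 1 + ‖p.2.1‖ ^ 2 := by positivity
    have hs := Real.sqrt_pos.2 hp
    have hsC : ((Real.sqrt (1 + ‖p.2.1‖ ^ 2) : ℝ) : ℂ) ≠ 0 := by exact_mod_cast hs.ne'
    have hN : ‖(((Real.sqrt (1 + ‖p.2.1‖ ^ 2))⁻¹ : ℝ) : ℂ) * (p.1 : ℂ)‖ =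
        (Real.sqrt (1 + ‖p.2.1‖ ^ 2))⁻¹ := by
      rw [norm_mul, Circle.norm_coe, Complex.norm_real, norm_inv, Real.norm_of_nonneg hs.le, mul_one]
    refine Prod.ext (Subtype.ext ?_) (Subtype.ext ?_)
    · simp only [auxA_auxJ]
      rw [hN]
      push_cast
      field_simp
    · simp only [auxA_auxJ, auxB_auxJ]
      rw [hN, inv_inv, smul_smul, mul_inv_cancel₀ hs.ne', one_smul]
  continuous_toFun := by
    have hA : Continuous fun v : ↥(Omega (m + 1) 1) => auxA v.1 :=
      aux_continuousA.comp continuous_subtype_val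
    have hB : Continuous fun v : ↥(Omega (m + 1) 1) => auxB v.1 :=
      aux_continuousB.comp continuous_subtype_val
    have hne : ∀ v : ↥(Omega (m + 1) 1), ‖auxA v.1‖ ≠ 0 := fun v =>
      norm_ne_zero_iff.2 ((aux_mem _).1 v.2).2.1
    refine Continuous.prodMk (Continuous.subtype_mk ?_ _) (Continuous.subtype_mk ?_ _)
    · exact hA.div (Complex.continuous_ofReal.comp hA.norm) fun v => by exact_mod_cast hne v
    · exact (hA.norm.inv₀ hne).smul hB
  continuous_invFun := by
    refine Continuous.subtype_mk ?_ _
    have hs : Continuous fun p : Circle × ({0}ᶜ : Set (EuclideanSpace ℝ (Fin m))) =>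
        (Real.sqrt (1 + ‖p.2.1‖ ^ 2))⁻¹ := by
      refine Continuous.inv₀ (by fun_prop) fun p => ?_
      have hp : 0 < 1 + ‖p.2.1‖ ^ 2 := by positivity
      exact (Real.sqrt_pos.2 hp).ne'
    refine aux_continuousJ.comp (Continuous.prodMk ?_ ?_)
    · exact (Complex.continuous_ofReal.comp hs).mul
        (continuous_subtype_val.comp continuous_fst)
    · exact hs.smul (continuous_subtype_val.comp continuous_snd)

/-- For `n ≥ 4`, `p = 1`, `q = n - 2`, the fundamental group of
`Ω = S^n ∖ (S^1 ∪ S^{n-2})` is isomorphic to `ℤ`. -/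
theorem omega_fundamentalGroup_int (n : ℕ) (hn : 4 ≤ n) (x : ↥(Omega n 1)) :
    Nonempty (FundamentalGroup ↥(Omega n 1) x ≃* Multiplicative ℤ) := by
  obtain ⟨m, rfl⟩ : ∃ m, n = m + 1 := ⟨n - 1, by omega⟩
  have : SimplyConnectedSpace ({0}ᶜ : Set (EuclideanSpace ℝ (Fin m))) :=
    aux_simplyConnected (by simp; omega)
  obtain ⟨e1⟩ := aux_prod (auxHomeo m) x
  obtain ⟨e2⟩ := aux_circle (auxHomeo m x).1
  exact ⟨e1.trans e2⟩
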